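/- arXiv:2010.03676 — 2 statements merged into one kernel-verified Lean document; each statement's English description precedes it below -/
import Mathlib

section
/- Let A be a closable subgroup of a group Γ, and let p be a positive integer. For j = 1, …, p let x^{(j)}₁, …, x^{(j)}_{m_j} be an A-admissible sequence in Γ. Then the concatenated sequence x^{(1)}₁, …, x^{(1)}_{m₁}, x^{(2)}₁, …, x^{(2)}_{m₂}, …, x^{(p)}₁, …, x^{(p)}_{m_p} of elements of Γ is A-admissible. -/
/-- The rank of a subgroup, as an extended natural number: the minimal cardinality of a
finite generating set, or `⊤` if the subgroup is not finitely generated. -/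
noncomputable def subgroupRank {Γ : Type*} [Group Γ] (H : Subgroup Γ) : ℕ∞ :=
  ⨅ (S : Finset Γ) (_ : Subgroup.closure (S : Set Γ) = H), (S.card : ℕ∞)

/-- `A` has local rank at most `r` if every finitely generated subgroup of `A` is contained
in a subgroup of `A` of rank at most `r`. -/
def LocalRankLE {Γ : Type*} [Group Γ] (A : Subgroup Γ) (r : ℕ) : Prop :=
  ∀ B : Subgroup Γ, B ≤ A → B.FG →
    ∃ C : Subgroup Γ, C ≤ A ∧ B ≤ C ∧ subgroupRank C ≤ (r : ℕ∞)

/-- The local rank of a subgroup: the least `r` such that `LocalRankLE A r`, or `⊤` if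
there is no such `r`. -/
noncomputable def localRank {Γ : Type*} [Group Γ] (A : Subgroup Γ) : ℕ∞ :=
  ⨅ (r : ℕ) (_ : LocalRankLE A r), (r : ℕ∞)

/-- A group is `k`-free if every subgroup of rank at most `k` is free. -/
def KFree (Γ : Type*) [Group Γ] (k : ℕ) : Prop :=
  ∀ H : Subgroup Γ, subgroupRank H ≤ (k : ℕ∞) → IsFreeGroup H

/-- The index of freedom of `Γ`: the supremum of all `k` such that `Γ` is `k`-free. -/
noncomputable def iof (Γ : Type*) [Group Γ] : ℕ∞ :=
  ⨆ (k : ℕ) (_ : KFree Γ k), (k : ℕ∞)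

/-- A subgroup `A` of `Γ` is strongly closable if `localRank A < iof Γ`. -/
def StronglyClosable {Γ : Type*} [Group Γ] (A : Subgroup Γ) : Prop :=
  localRank A < iof Γ

/-- A subgroup `A` of `Γ` is closable if it has finite local rank and there is some `z ∈ Γ`
with `localRank ⟨A, z⟩ < iof Γ`. -/
def Closable {Γ : Type*} [Group Γ] (A : Subgroup Γ) : Prop :=
  localRank A < ⊤ ∧ ∃ z : Γ, localRank (A ⊔ Subgroup.closure {z}) < iof Γ

/-- An element `x` of `Γ` is `A`-admissible if `⟨A, x⟩` is strongly closable and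
`localRank ⟨A, x⟩ ≤ localRank A`. -/
def Admissible {Γ : Type*} [Group Γ] (A : Subgroup Γ) (x : Γ) : Prop :=
  StronglyClosable (A ⊔ Subgroup.closure {x}) ∧
    localRank (A ⊔ Subgroup.closure {x}) ≤ localRank A

/-- A sequence `x₁, …, x_m` is `A`-admissible if each `x_i` is `⟨A, x₁, …, x_{i-1}⟩`-admissible. -/
def AdmissibleSeq {Γ : Type*} [Group Γ] : Subgroup Γ → List Γ → Prop
  | _, [] => True
  | A, x :: xs => Admissible A x ∧ AdmissibleSeq (A ⊔ Subgroup.closure {x}) xs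

/-- `clo A` is the set of all `x ∈ Γ` which occur as the last term of an `A`-admissible
sequence. -/
def clo {Γ : Type*} [Group Γ] (A : Subgroup Γ) : Set Γ :=
  { x | ∃ l : List Γ, AdmissibleSeq A (l ++ [x]) }

/-- The homomorphism `ι_{A,x}` from the free product `A ∗ ⟨t⟩` to `Γ` restricting to the
inclusion on `A` and sending `t` to `x`. -/
noncomputable def iotaAX {Γ : Type*} [Group Γ] (A : Subgroup Γ) (x : Γ) :
    Monoid.Coprod (↥A) (Multiplicative ℤ) →* Γ :=
  Monoid.Coprod.lift A.subtype (zpowersHom Γ x)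

/-- Elements `g 0, …, g (m-1)` of `Γ` are independent if they freely generate a free subgroup,
i.e. the induced homomorphism from the free group on `m` generators is injective. -/
def Independent {Γ : Type*} [Group Γ] {m : ℕ} (g : Fin m → Γ) : Prop :=
  Function.Injective (FreeGroup.lift g : FreeGroup (Fin m) →* Γ)

theorem aux_resfin {α : Type*} (w : FreeGroup α) (hw : w ≠ 1) :
    ∃ (V : Set (FreeGroup α)) (_ : Finite V) (f : FreeGroup α →* Equiv.Perm V), f w ≠ 1 := by
  classical
  obtain ⟨L, rfl⟩ : ∃ L, w = FreeGroup.mk L := ⟨w.toWord, FreeGroup.mk_toWord.symm⟩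
  let V : Set (FreeGroup α) := {v | v ∈ L.tails.map FreeGroup.mk}
  have hV : V.Finite := List.finite_toSet _
  have hmem : ∀ l, l <:+ L → FreeGroup.mk l ∈ V := fun l hl =>
    List.mem_map.2 ⟨l, (List.mem_tails _ _).2 hl, rfl⟩
  have : Finite V := hV
  let : Fintype V := Fintype.ofFinite V
  have key : ∀ a : α, ∃ σ : Equiv.Perm V, ∀ v : V, ∀ h : FreeGroup.of a * v.1 ∈ V,
      σ v = ⟨FreeGroup.of a * v.1, h⟩ := by
    intro a
    let e : {v : V // FreeGroup.of a * v.1 ∈ V} ≃ {v : V // (FreeGroup.of a)⁻¹ * v.1 ∈ V} :=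
      { toFun := fun v => ⟨⟨FreeGroup.of a * v.1.1, v.2⟩, by simp⟩
        invFun := fun v => ⟨⟨(FreeGroup.of a)⁻¹ * v.1.1, v.2⟩, by simp⟩
        left_inv := fun v => by ext; simp
        right_inv := fun v => by ext; simp }
    refine ⟨e.extendSubtype, fun v h => ?_⟩
    rw [Equiv.extendSubtype_apply_of_mem e v h]
    rfl
  choose σ hσ using key
  have h1 : (1 : FreeGroup α) ∈ V := hmem [] (List.nil_suffix)
  have main : ∀ l (hl : l <:+ L), FreeGroup.lift σ (FreeGroup.mk l) ⟨1, h1⟩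
      = ⟨FreeGroup.mk l, hmem l hl⟩ := by
    intro l
    induction l with
    | nil => intro hl; exact congrArg (fun q : Equiv.Perm V => q ⟨1, h1⟩) (map_one (FreeGroup.lift σ))
    | cons p l ih =>
      intro hl
      obtain ⟨a, b⟩ := p
      have hl' : l <:+ L := (List.suffix_cons _ _).trans hl
      have hm : FreeGroup.mk ((a, b) :: l) = FreeGroup.mk [(a, b)] * FreeGroup.mk l := by
        rw [FreeGroup.mul_mk]; rfl
      have hin := hmem _ hl
      cases b with
      | true =>
        have hm' : FreeGroup.mk ((a, true) :: l) = FreeGroup.of a * FreeGroup.mk l := hm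
        simp only [hm'] at hin ⊢
        rw [map_mul, Equiv.Perm.mul_apply, ih hl', FreeGroup.lift_apply_of]
        exact hσ a ⟨_, hmem l hl'⟩ hin
      | false =>
        have hm' : FreeGroup.mk ((a, false) :: l) = (FreeGroup.of a)⁻¹ * FreeGroup.mk l := by
          rw [hm]; simp [FreeGroup.of, FreeGroup.inv_mk, FreeGroup.invRev]
        simp only [hm'] at hin ⊢
        rw [map_mul, Equiv.Perm.mul_apply, ih hl', map_inv, FreeGroup.lift_apply_of,
          Equiv.Perm.inv_eq_iff_eq]
        rw [hσ a ⟨_, hin⟩ (by simpa using hmem l hl')]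
        simp
  refine ⟨V, inferInstance, FreeGroup.lift σ, fun h => hw ?_⟩
  have := main L (List.suffix_refl _)
  rw [h] at this
  exact (congrArg Subtype.val this).symm

theorem aux_rank_le {Γ : Type*} [Group Γ] {X : Type*} [Finite X] (g : X → Γ) :
    subgroupRank (Subgroup.closure (Set.range g)) ≤ (Nat.card X : ℕ∞) := by
  classical
  let := Fintype.ofFinite X
  refine (iInf₂_le (Finset.univ.image g) (by simp)).trans ?_
  rw [Nat.card_eq_fintype_card]
  exact_mod_cast Finset.card_image_le

theorem aux_exists_gen {Γ : Type*} [Group Γ] (H : Subgroup Γ) (r : ℕ)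
    (h : subgroupRank H ≤ (r : ℕ∞)) : ∃ g : Fin r → Γ, Subgroup.closure (Set.range g) = H := by
  classical
  have : ∃ S : Finset Γ, Subgroup.closure (S : Set Γ) = H ∧ S.card ≤ r := by
    by_contra hc
    push Not at hc
    have : ((r + 1 : ℕ) : ℕ∞) ≤ subgroupRank H :=
      le_iInf₂ fun S hS => by exact_mod_cast hc S hS
    have := this.trans h
    norm_cast at this
    omega
  obtain ⟨S, hS, hc⟩ := this
  refine ⟨fun i => if hi : i.1 < S.card then (S.equivFin.symm ⟨i, hi⟩ : Γ) else 1, ?_⟩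
  apply le_antisymm
  · rw [Subgroup.closure_le]
    rintro _ ⟨i, rfl⟩
    dsimp only
    split_ifs with hi
    · rw [← hS]; exact Subgroup.subset_closure (S.equivFin.symm ⟨i, hi⟩).2
    · exact H.one_mem
  · rw [← hS, Subgroup.closure_le]
    intro y hy
    refine Subgroup.subset_closure ⟨⟨(S.equivFin ⟨y, hy⟩).1, by omega⟩, ?_⟩
    simp

theorem aux_core {Γ : Type*} [Group Γ] (n : ℕ) (φ : FreeGroup (Fin n) →* Γ)
    (hfree : IsFreeGroup φ.range) (w : FreeGroup (Fin n)) (hw : w ≠ 1) (h : φ w = 1) :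
    ∃ m : ℕ, m + 1 ≤ n ∧ subgroupRank φ.range ≤ (m : ℕ∞) := by
  classical
  obtain ⟨X, ⟨b⟩⟩ := hfree.nonempty_basis
  have hinj : ∀ (Q : Type) [Group Q], Function.Injective
      (fun (f : X → Q) (i : Fin n) => b.lift f (φ.rangeRestrict (FreeGroup.of i))) := by
    intro Q _ f g hfg
    apply b.lift.injective
    have : (b.lift f).comp φ.rangeRestrict = (b.lift g).comp φ.rangeRestrict :=
      FreeGroup.ext_hom _ _ fun i => congrFun hfg i
    exact (MonoidHom.cancel_right φ.rangeRestrict_surjective).1 this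
  let Q := Multiplicative (ZMod 2)
  have hi := hinj Q
  have : Finite Q := inferInstanceAs (Finite (ZMod 2))
  have hQ : Nat.card Q = 2 := by
    show Nat.card (ZMod 2) = 2
    simp
  have hfinX : Finite (X → Q) := Finite.of_injective _ hi
  have : Finite X := by
    refine Finite.of_injective
      (fun x : X => (fun y => if y = x then Multiplicative.ofAdd (1 : ZMod 2) else 1 : X → Q)) ?_
    intro x y hxy
    by_contra hne
    have := congrFun hxy x
    simp [hne] at this
    exact absurd (congrArg Multiplicative.toAdd this) (by decide)
  have hcard : Nat.card X ≤ n := by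
    have := Nat.card_le_card_of_injective _ hi
    rw [Nat.card_fun, Nat.card_fun, hQ, Nat.card_fin] at this
    exact (Nat.pow_le_pow_iff_right (by norm_num)).1 this
  refine ⟨Nat.card X, ?_, ?_⟩
  · by_contra hlt
    have hXn : Nat.card X = n := by omega
    obtain ⟨V, hV, f, hf⟩ := aux_resfin w hw
    have hi := hinj (Equiv.Perm V)
    have e : X ≃ Fin n := Finite.equivFinOfCardEq hXn
    have hs := (Finite.injective_iff_surjective_of_equiv (e.arrowCongr (Equiv.refl _))).1 hi
    obtain ⟨k, hk⟩ := hs (fun i => f (FreeGroup.of i))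
    have : (b.lift k).comp φ.rangeRestrict = f := FreeGroup.ext_hom _ _ fun i => congrFun hk i
    apply hf
    rw [← this, MonoidHom.comp_apply]
    have h1 : φ.rangeRestrict w = 1 := Subtype.ext h
    rw [h1, map_one]
  · have : φ.range = Subgroup.closure (Set.range fun x => ((b x : φ.range) : Γ)) := by
      let ψ : FreeGroup X →* Γ := φ.range.subtype.comp b.repr.symm.toMonoidHom
      have h1 : ψ.range = φ.range := by
        ext y
        constructor
        · rintro ⟨v, rfl⟩
          exact (b.repr.symm v).2
        · intro hy
          refine ⟨b.repr ⟨y, hy⟩, ?_⟩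
          simp [ψ]
      have h2 : ψ = FreeGroup.lift fun x => ((b x : φ.range) : Γ) := by
        ext x
        simp [ψ]
        rfl
      rw [← FreeGroup.range_lift_eq_closure, ← h2, h1]
    rw [this]
    exact aux_rank_le _

theorem aux_lr_iff {Γ : Type*} [Group Γ] (A : Subgroup Γ) (r : ℕ) :
    localRank A ≤ (r : ℕ∞) ↔ LocalRankLE A r := by
  refine ⟨fun h => ?_, fun h => iInf₂_le r h⟩
  have : ∃ s, LocalRankLE A s ∧ s ≤ r := by
    by_contra hc
    push Not at hc
    have : ((r + 1 : ℕ) : ℕ∞) ≤ localRank A :=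
      le_iInf₂ fun S hS => by exact_mod_cast hc S hS
    have := this.trans h
    norm_cast at this
    omega
  obtain ⟨s, hs, hsr⟩ := this
  intro B hB hfg
  obtain ⟨C, h1, h2, h3⟩ := hs B hB hfg
  exact ⟨C, h1, h2, h3.trans (by exact_mod_cast hsr)⟩

theorem aux_free {Γ : Type*} [Group Γ] (s : ℕ) (h : (s : ℕ∞) < iof Γ) : KFree Γ (s + 1) := by
  obtain ⟨k, hk⟩ := lt_iSup_iff.1 h
  obtain ⟨hk', hk⟩ := lt_iSup_iff.1 hk
  intro H hH
  have : s + 1 ≤ k := by exact_mod_cast hk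
  exact hk' H (hH.trans (by exact_mod_cast this))

/-- existence of a retraction killing `x` and fixing `S` -/
def AuxRet {Γ : Type*} [Group Γ] (S : Set Γ) (x : Γ) : Prop :=
  x ≠ 1 ∧ ∃ (K : Subgroup Γ) (ρ : K →* Γ), S ⊆ K ∧ x ∈ K ∧
    (∀ k : K, k.1 ∈ S → ρ k = k.1) ∧ (∀ k : K, k.1 = x → ρ k = 1)

/-- `x` is dependent over `A` -/
def AuxDep {Γ : Type*} [Group Γ] (A : Subgroup Γ) (x : Γ) : Prop :=
  ∃ S : Finset Γ, (S : Set Γ) ⊆ A ∧ ¬ AuxRet (S : Set Γ) x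

theorem aux_fg_sup {Γ : Type*} [Group Γ] (A : Subgroup Γ) (x : Γ) (T : Finset Γ)
    (hT : (T : Set Γ) ⊆ (A ⊔ Subgroup.closure {x} : Subgroup Γ)) :
    ∃ S : Finset Γ, (S : Set Γ) ⊆ A ∧
      (T : Set Γ) ⊆ (Subgroup.closure (S : Set Γ) ⊔ Subgroup.closure {x} : Subgroup Γ) := by
  classical
  have mono : ∀ S S' : Finset Γ, S ⊆ S' →
      (Subgroup.closure (S : Set Γ) ⊔ Subgroup.closure {x} : Subgroup Γ) ≤
      Subgroup.closure (S' : Set Γ) ⊔ Subgroup.closure {x} := fun S S' h =>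
    sup_le_sup_right (Subgroup.closure_mono (by exact_mod_cast h)) _
  have key : ∀ y ∈ A ⊔ Subgroup.closure {x}, ∃ S : Finset Γ, (S : Set Γ) ⊆ A ∧
      y ∈ Subgroup.closure (S : Set Γ) ⊔ Subgroup.closure {x} := by
    intro y hy
    rw [← Subgroup.closure_eq A, ← Subgroup.closure_union] at hy
    induction hy using Subgroup.closure_induction with
    | mem y hy =>
      rcases hy with hy | hy
      · exact ⟨{y}, by simpa using hy, Subgroup.mem_sup_left (Subgroup.subset_closure (by simp))⟩
      · exact ⟨∅, by simp, Subgroup.mem_sup_right (Subgroup.subset_closure hy)⟩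
    | one => exact ⟨∅, by simp, Subgroup.one_mem _⟩
    | mul y z _ _ h1 h2 =>
      obtain ⟨S, hS, hy⟩ := h1
      obtain ⟨S', hS', hz⟩ := h2
      exact ⟨S ∪ S', by simp [hS, hS'], Subgroup.mul_mem _
        (mono _ _ Finset.subset_union_left hy) (mono _ _ Finset.subset_union_right hz)⟩
    | inv y _ h1 =>
      obtain ⟨S, hS, hy⟩ := h1
      exact ⟨S, hS, Subgroup.inv_mem _ hy⟩
  induction T using Finset.induction_on with
  | empty => exact ⟨∅, by simp, by simp⟩
  | insert a T _ ih =>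
    rw [Finset.coe_insert, Set.insert_subset_iff] at hT
    obtain ⟨S, hS, h1⟩ := ih hT.2
    obtain ⟨S', hS', h2⟩ := key a hT.1
    refine ⟨S ∪ S', by simp [hS, hS'], ?_⟩
    rw [Finset.coe_insert, Set.insert_subset_iff]
    exact ⟨mono _ _ Finset.subset_union_right h2,
      fun y hy => mono _ _ Finset.subset_union_left (h1 hy)⟩

theorem aux_dep_of_adm {Γ : Type*} [Group Γ] (A : Subgroup Γ) (x : Γ) (h : Admissible A x) :
    AuxDep A x := by
  classical
  by_contra hd
  have hret : ∀ S : Finset Γ, (S : Set Γ) ⊆ A → AuxRet (S : Set Γ) x := by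
    intro S hS
    by_contra hc
    exact hd ⟨S, hS, hc⟩
  obtain ⟨h1, h2⟩ := h
  have hx : x ≠ 1 := (hret ∅ (by simp)).1
  unfold StronglyClosable at h1
  obtain ⟨s, hs⟩ := ENat.ne_top_iff_exists.1 (ne_top_of_lt h1)
  rw [← hs] at h1 h2
  have hl := (aux_lr_iff _ s).1 hs.symm.le
  have hfree := aux_free s h1
  have main : ∀ B : Subgroup Γ, B ≤ A → B.FG →
      ∃ m, m + 1 ≤ s ∧ ∃ C : Subgroup Γ, C ≤ A ∧ B ≤ C ∧ subgroupRank C ≤ (m : ℕ∞) := by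
    rintro B hBA ⟨T, rfl⟩
    have hTA : (T : Set Γ) ⊆ A := (Subgroup.closure_le _).1 hBA
    obtain ⟨C, hC, hBC, hr⟩ := hl (Subgroup.closure (T : Set Γ) ⊔ Subgroup.closure {x})
      (sup_le_sup_right hBA _) (Subgroup.FG.sup ⟨T, rfl⟩ ⟨{x}, by simp⟩)
    obtain ⟨g, rfl⟩ := aux_exists_gen C s hr
    obtain ⟨S, hS, hgS⟩ := aux_fg_sup A x (Finset.univ.image g) (by
      simpa using (Subgroup.closure_le _).1 hC)
    obtain ⟨-, K, ρ, hSK, hxK, hρS, hρx⟩ := hret (S ∪ T) (by simp [hS, hTA])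
    rw [Finset.coe_union, Set.union_subset_iff] at hSK
    -- the subgroup generated by S and x
    have hLK : Subgroup.closure (S : Set Γ) ⊔ Subgroup.closure {x} ≤ K :=
      sup_le ((Subgroup.closure_le _).2 hSK.1) ((Subgroup.closure_le _).2 (by simpa using hxK))
    have hgL : ∀ i, g i ∈ Subgroup.closure (S : Set Γ) ⊔ Subgroup.closure {x} := fun i =>
      hgS (by simp)
    have hgK : ∀ i, g i ∈ K := fun i => hLK (hgL i)
    have hρA : ∀ i, ρ ⟨g i, hgK i⟩ ∈ A := by
      have : Subgroup.closure (S : Set Γ) ⊔ Subgroup.closure {x} ≤ (A.comap ρ).map K.subtype := by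
        refine sup_le ((Subgroup.closure_le _).2 ?_) ((Subgroup.closure_le _).2 ?_)
        · intro y hy
          refine ⟨⟨y, hSK.1 hy⟩, ?_, rfl⟩
          show ρ _ ∈ A
          rw [hρS _ (by simp; exact Or.inl hy)]
          exact hS hy
        · rintro y rfl
          refine ⟨⟨_, hxK⟩, ?_, rfl⟩
          show ρ _ ∈ A
          rw [hρx _ rfl]
          exact A.one_mem
      intro i
      obtain ⟨k, hk, hk'⟩ := this (hgL i)
      have : k = ⟨g i, hgK i⟩ := Subtype.ext hk'
      rw [← this]; exact hk
    let g' : Fin s → K := fun i => ⟨g i, hgK i⟩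
    let ψ : FreeGroup (Fin s) →* K := FreeGroup.lift g'
    let φ : FreeGroup (Fin s) →* Γ := ρ.comp ψ
    have hψ : K.subtype.comp ψ = FreeGroup.lift g := by
      ext i; simp [ψ, g']
    have hφ : φ = FreeGroup.lift fun i => ρ (g' i) := by
      ext i; simp [φ, ψ]
    have hφr : φ.range = Subgroup.closure (Set.range fun i => ρ (g' i)) := by
      rw [hφ, FreeGroup.range_lift_eq_closure]
    have hlift : ∀ y ∈ Subgroup.closure (Set.range g), ∃ w, ((ψ w : K) : Γ) = y := by
      intro y hy
      rw [← FreeGroup.range_lift_eq_closure, ← hψ] at hy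
      exact hy
    have hfr : IsFreeGroup φ.range := by
      apply hfree
      rw [hφr]
      refine (aux_rank_le _).trans ?_
      rw [Nat.card_fin]
      exact_mod_cast Nat.le_succ s
    obtain ⟨w, hw⟩ := hlift x (hBC (Subgroup.mem_sup_right (Subgroup.subset_closure rfl)))
    obtain ⟨m, hm, hmr⟩ := aux_core s φ hfr w (by
      rintro rfl
      apply hx
      rw [← hw]; simp) (hρx _ hw)
    refine ⟨m, hm, φ.range, ?_, ?_, hmr⟩
    · rw [hφr, Subgroup.closure_le]
      rintro _ ⟨i, rfl⟩
      exact hρA i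
    · rw [Subgroup.closure_le]
      intro t ht
      obtain ⟨v, hv⟩ := hlift t (hBC (Subgroup.mem_sup_left (Subgroup.subset_closure ht)))
      refine ⟨v, ?_⟩
      show ρ (ψ v) = t
      rw [hρS _ (by rw [hv]; simp; exact Or.inr ht), hv]
  obtain ⟨m0, hm0, -⟩ := main ⊥ bot_le ⟨∅, by simp⟩
  have : localRank A ≤ ((s - 1 : ℕ) : ℕ∞) := by
    rw [aux_lr_iff]
    intro B hB hfg
    obtain ⟨m, hm, C, h1, h2, h3⟩ := main B hB hfg
    have : m ≤ s - 1 := by omega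
    exact ⟨C, h1, h2, h3.trans (by exact_mod_cast this)⟩
  have := h2.trans this
  norm_cast at this
  omega

theorem aux_adm_of_dep {Γ : Type*} [Group Γ] (A : Subgroup Γ) (x : Γ) (h : AuxDep A x)
    (hA : StronglyClosable A) : Admissible A x := by
  classical
  suffices hle : localRank (A ⊔ Subgroup.closure {x}) ≤ localRank A from ⟨hle.trans_lt hA, hle⟩
  unfold StronglyClosable at hA
  obtain ⟨s, hs⟩ := ENat.ne_top_iff_exists.1 (ne_top_of_lt hA)
  rw [← hs] at hA ⊢
  have hl := (aux_lr_iff _ s).1 hs.symm.le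
  have hfree := aux_free s hA
  obtain ⟨S, hS, hnr⟩ := h
  rw [aux_lr_iff]
  rintro B hB ⟨T, rfl⟩
  obtain ⟨S', hS', hT⟩ := aux_fg_sup A x T ((Subgroup.closure_le _).1 hB)
  obtain ⟨C, hCA, hSC, hr⟩ := hl (Subgroup.closure ((S ∪ S' : Finset Γ) : Set Γ))
    ((Subgroup.closure_le _).2 (by simp [hS, hS'])) ⟨_, rfl⟩
  obtain ⟨g, rfl⟩ := aux_exists_gen C s hr
  rw [Subgroup.closure_le, Finset.coe_union, Set.union_subset_iff] at hSC
  let g' : Fin (s + 1) → Γ := Fin.cons x g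
  let φ : FreeGroup (Fin (s + 1)) →* Γ := FreeGroup.lift g'
  have hφr : φ.range = Subgroup.closure (Set.range g) ⊔ Subgroup.closure {x} := by
    rw [FreeGroup.range_lift_eq_closure, Fin.range_cons, Set.insert_eq, Subgroup.closure_union,
      sup_comm]
  have hfr : IsFreeGroup φ.range := by
    apply hfree
    rw [FreeGroup.range_lift_eq_closure]
    refine (aux_rank_le _).trans ?_
    rw [Nat.card_fin]
  have hninj : ¬ Function.Injective φ := by
    intro hinj
    apply hnr
    let e := MonoidHom.ofInjective hinj
    have hx : φ (FreeGroup.of 0) = x := by simp [φ, g']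
    refine ⟨?_, φ.range,
      (FreeGroup.lift (Fin.cons 1 g : Fin (s + 1) → Γ)).comp e.symm.toMonoidHom, ?_, ?_, ?_, ?_⟩
    · rintro rfl
      exact FreeGroup.of_ne_one (0 : Fin (s + 1)) (hinj (by rw [hx, map_one]))
    · intro y hy
      rw [hφr]
      exact Subgroup.mem_sup_left (hSC.1 hy)
    · exact ⟨_, hx⟩
    · rintro ⟨y, hy⟩ hyS
      have hyg := hSC.1 hyS
      change y ∈ Subgroup.closure (Set.range g) at hyg
      rw [← FreeGroup.range_lift_eq_closure] at hyg
      obtain ⟨v, rfl⟩ := hyg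
      have h1 : ∀ c : Γ, FreeGroup.lift (Fin.cons c g : Fin (s + 1) → Γ)
          (FreeGroup.map Fin.succ v) = FreeGroup.lift g v := by
        intro c
        have : (FreeGroup.lift (Fin.cons c g : Fin (s + 1) → Γ)).comp (FreeGroup.map Fin.succ)
          = FreeGroup.lift g := by ext i; simp
        exact DFunLike.congr_fun this v
      have h2 : e.symm ⟨FreeGroup.lift g v, hy⟩ = FreeGroup.map Fin.succ v := by
        rw [MulEquiv.symm_apply_eq]
        exact Subtype.ext (h1 x).symm
      show FreeGroup.lift _ (e.symm ⟨FreeGroup.lift g v, hy⟩) = _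
      rw [h2, h1]
    · rintro ⟨y, hy⟩ hyx
      have h2 : e.symm ⟨y, hy⟩ = FreeGroup.of 0 := by
        rw [MulEquiv.symm_apply_eq]
        exact Subtype.ext (hyx.trans hx.symm)
      show FreeGroup.lift _ (e.symm ⟨y, hy⟩) = _
      rw [h2]
      simp
  rw [injective_iff_map_eq_one] at hninj
  push Not at hninj
  obtain ⟨w, hw, hw1⟩ := hninj
  obtain ⟨m, hm, hmr⟩ := aux_core _ φ hfr w hw1 hw
  have hms : m ≤ s := by omega
  refine ⟨φ.range, ?_, ?_, hmr.trans (by exact_mod_cast hms)⟩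
  · rw [hφr]; exact sup_le_sup_right hCA _
  · rw [hφr, Subgroup.closure_le]
    intro t ht
    exact sup_le_sup_right ((Subgroup.closure_le _).2 hSC.2) _ (hT ht)

theorem aux_seq_mono {Γ : Type*} [Group Γ] (l : List Γ) : ∀ (A B : Subgroup Γ), A ≤ B →
    StronglyClosable B → AdmissibleSeq A l → AdmissibleSeq B l := by
  induction l with
  | nil => intros; trivial
  | cons x l ih =>
    rintro A B hAB hB ⟨h1, h2⟩
    obtain ⟨S, hS, hr⟩ := aux_dep_of_adm A x h1
    have hadm := aux_adm_of_dep B x ⟨S, hS.trans hAB, hr⟩ hB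
    exact ⟨hadm, ih _ _ (sup_le_sup_right hAB _) hadm.1 h2⟩

theorem aux_append {Γ : Type*} [Group Γ] (A : Subgroup Γ) (l' : List Γ) (h' : AdmissibleSeq A l')
    (l : List Γ) : ∀ (B : Subgroup Γ), A ≤ B → AdmissibleSeq B l' → AdmissibleSeq B l →
    AdmissibleSeq B (l ++ l') := by
  induction l with
  | nil => intro B _ h _; exact h
  | cons x l ih =>
    rintro B hAB _ ⟨h1, h2⟩
    have hA : A ≤ B ⊔ Subgroup.closure {x} := hAB.trans le_sup_left
    exact ⟨h1, ih _ hA (aux_seq_mono _ _ _ hA h1.1 h') h2⟩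

theorem aux_flatten {Γ : Type*} [Group Γ] (A : Subgroup Γ) (L : List (List Γ))
    (h : ∀ l ∈ L, AdmissibleSeq A l) : AdmissibleSeq A L.flatten := by
  induction L with
  | nil => trivial
  | cons l L ih =>
    rw [List.flatten_cons]
    have h1 := ih fun l hl => h l (List.mem_cons_of_mem _ hl)
    exact aux_append A _ h1 l A le_rfl h1 (h l List.mem_cons_self)

/-- The concatenation of finitely many `A`-admissible sequences is `A`-admissible, for a
closable subgroup `A`. -/
theorem admissibleSeq_concat {Γ : Type*} [Group Γ] (A : Subgroup Γ) (hA : Closable A)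
    (p : ℕ) (hp : 0 < p) (seqs : Fin p → List Γ) (hne : ∀ j, seqs j ≠ [])
    (h : ∀ j, AdmissibleSeq A (seqs j)) :
    AdmissibleSeq A (List.ofFn seqs).flatten := by
  refine aux_flatten A _ fun l hl => ?_
  obtain ⟨j, rfl⟩ := List.mem_ofFn.1 hl
  exact h j
end

section
/- Let A be a closable subgroup of a group Γ, and let S be a finite subset of clo(A). Then there is an A-admissible sequence y₁, …, y_q such that {y₁, …, y_q} ⊇ S. -/
open Monoid.Coprod in
theorem coprod_map_inj {A B Z : Type*} [Group A] [Group B] [Group Z] (f : A →* B)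
    (hf : Function.Injective f) :
    Function.Injective (Monoid.Coprod.map f (MonoidHom.id Z)) := by
  classical
  let G := Monoid.Coprod A Z
  let H : Subgroup G := (inl : A →* G).range
  obtain ⟨T, hT, -⟩ := H.exists_isComplement_right 1
  -- `e : H × T ≃ G`
  let e : H × T ≃ G := Equiv.ofBijective _ hT
  have he : ∀ p, e p = (p.1 : G) * (p.2 : G) := fun p => rfl
  let j0 : G → B × T := fun x => (f (fst ((e.symm x).1 : G)), (e.symm x).2)
  have hfi : ∀ h : H, (inl (fst (h : G)) : G) = h := by
    rintro ⟨_, a, rfl⟩; simp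
  have hj0 : Function.Injective j0 := by
    intro x y hxy
    simp only [j0, Prod.mk.injEq] at hxy
    apply e.symm.injective
    refine Prod.ext ?_ hxy.2
    apply Subtype.ext
    rw [← hfi (e.symm x).1, ← hfi (e.symm y).1, hf hxy.1]
  let j : G ↪ B × T := ⟨j0, hj0⟩
  let α : B →* Equiv.Perm (B × T) :=
    { toFun := fun b => (Equiv.mulLeft b).prodCongr (Equiv.refl T)
      map_one' := by ext x <;> simp
      map_mul' := by intro x y; ext z <;> simp [mul_assoc] }
  let β : Z →* Equiv.Perm (B × T) :=
    ((Equiv.Perm.viaEmbeddingHom j).comp (MulAction.toPermHom G G)).comp inr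
  have key : ∀ w : G, ∀ x : G,
      (lift α β) (Monoid.Coprod.map f (MonoidHom.id Z) w) (j x) = j (w * x) := by
    intro w
    induction w using Monoid.Coprod.induction_on with
    | inl a =>
      intro x
      have h1 : e.symm (inl a * x) = (⟨inl a, a, rfl⟩ * (e.symm x).1, (e.symm x).2) := by
        rw [Equiv.symm_apply_eq, he]
        have := he (e.symm x)
        rw [Equiv.apply_symm_apply] at this
        simp only [Subgroup.coe_mul, mul_assoc, ← this]
      simp only [map_apply_inl, lift_apply_inl]
      change α (f a) (j0 x) = j0 (inl a * x)
      simp [j0, h1, α]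
    | inr z =>
      intro x
      simp only [map_apply_inr, lift_apply_inr, MonoidHom.id_apply]
      simp only [β, MonoidHom.comp_apply, Equiv.Perm.viaEmbeddingHom_apply,
        Equiv.Perm.viaEmbedding_apply]
      rfl
    | mul u v hu hv =>
      intro x
      rw [map_mul, map_mul, Equiv.Perm.mul_apply, hv, hu, mul_assoc]
  rw [injective_iff_map_eq_one]
  intro w hw
  have := key w 1
  rw [hw] at this
  simpa using (j.injective this).symm

theorem freeGroup_exists_perm {α : Type*} (w : FreeGroup α) (hw : w ≠ 1) :
    ∃ (P : Type) (_ : Group P) (_ : Finite P) (φ : FreeGroup α →* P), φ w ≠ 1 := by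
  classical
  obtain ⟨L, rfl⟩ : ∃ L, w = FreeGroup.mk L := ⟨w.toWord, FreeGroup.mk_toWord.symm⟩
  let T : Finset (FreeGroup α) := L.tails.toFinset.image FreeGroup.mk
  have hT : ∀ l, l <:+ L → FreeGroup.mk l ∈ T := by
    intro l hl
    simp only [T, Finset.mem_image, List.mem_toFinset, List.mem_tails]
    exact ⟨l, hl, rfl⟩
  have ext : ∀ a : α, ∃ σ : Equiv.Perm T, ∀ x : T, ∀ h : FreeGroup.of a * (x : FreeGroup α) ∈ T,
      σ x = ⟨_, h⟩ := by
    intro a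
    let e : {x : T // FreeGroup.of a * (x : FreeGroup α) ∈ T} ≃
        {x : T // (FreeGroup.of a)⁻¹ * (x : FreeGroup α) ∈ T} :=
      { toFun := fun x => ⟨⟨_, x.2⟩, by simp⟩
        invFun := fun x => ⟨⟨_, x.2⟩, by simp⟩
        left_inv := fun x => by ext; simp
        right_inv := fun x => by ext; simp }
    refine ⟨e.extendSubtype, fun x h => ?_⟩
    rw [Equiv.extendSubtype_apply_of_mem e x h]
    rfl
  choose σ hσ using ext
  have h1 : (1 : FreeGroup α) ∈ T := hT [] (List.nil_suffix)
  have key : ∀ l, ∀ hl : l <:+ L, FreeGroup.lift σ (FreeGroup.mk l) ⟨1, h1⟩ = ⟨_, hT l hl⟩ := by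
    intro l
    induction l with
    | nil => intro _; rfl
    | cons a l ih =>
      intro hl
      have hl' : l <:+ L := (List.suffix_cons a l).trans hl
      obtain ⟨a, b⟩ := a
      have hm : FreeGroup.mk ((a, b) :: l) = FreeGroup.mk [(a,b)] * FreeGroup.mk l := by
        rw [FreeGroup.mul_mk]; rfl
      have hx := hT _ hl
      have : FreeGroup.lift σ (FreeGroup.mk ((a, b) :: l)) ⟨1, h1⟩
        = FreeGroup.lift σ (FreeGroup.mk [(a,b)]) ⟨_, hT l hl'⟩ := by
        rw [hm, map_mul, Equiv.Perm.mul_apply, ih hl']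
      rw [this]
      cases b with
      | true =>
        have h2 := hσ a ⟨_, hT l hl'⟩ (by rw [hm] at hx; exact hx)
        simp only [FreeGroup.lift_mk]
        simp only [List.map_cons, List.map_nil, List.prod_cons, List.prod_nil, mul_one, cond_true]
        rw [h2]
        apply Subtype.ext
        exact hm.symm
      | false =>
        have hq : FreeGroup.of a * FreeGroup.mk ((a, false) :: l) = FreeGroup.mk l := by
          rw [hm]
          have : FreeGroup.mk [(a, false)] = (FreeGroup.of a)⁻¹ := rfl
          rw [this]; simp
        have h2 := hσ a ⟨_, hx⟩ (by rw [hq]; exact hT l hl')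
        simp only [FreeGroup.lift_mk]
        simp only [List.map_cons, List.map_nil, List.prod_cons, List.prod_nil, mul_one, cond_false]
        rw [Equiv.Perm.inv_eq_iff_eq, h2]
        apply Subtype.ext
        exact hq.symm
  let n := Fintype.card T
  let ee : T ≃ Fin n := Fintype.equivFin T
  refine ⟨Equiv.Perm (Fin n), inferInstance, inferInstance,
    (ee.permCongrHom.toMonoidHom).comp (FreeGroup.lift σ), ?_⟩
  intro h
  have h2 : FreeGroup.lift σ (FreeGroup.mk L) = 1 := by
    apply ee.permCongrHom.injective
    rw [map_one]; exact h
  have := key L List.suffix_rfl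
  rw [h2] at this
  exact hw (congrArg Subtype.val this).symm

theorem freeGroup_rank_drop {s : ℕ} {G : Type*} [Group G] [IsFreeGroup G]
    (f : FreeGroup (Fin s) →* G) (hf : Function.Surjective f) (hni : ¬ Function.Injective f) :
    ∃ n < s, ∃ g : Fin n → G, Function.Surjective (FreeGroup.lift g) := by
  classical
  let ι := IsFreeGroup.Generators G
  let b : FreeGroupBasis ι G := IsFreeGroup.basis G
  have inj : ∀ (P : Type) [Group P], Function.Injective
      (fun (u : ι → P) (i : Fin s) => b.lift u (f (FreeGroup.of i))) := by
    intro P _ u v huv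
    apply b.lift.injective
    have : (b.lift u).comp f = (b.lift v).comp f := by
      ext i; exact congrFun huv i
    ext x
    obtain ⟨y, rfl⟩ := hf x
    exact DFunLike.congr_fun this y
  let C := Multiplicative (ZMod 2)
  have hfin : Finite ι := by
    have := Finite.of_injective _ (inj C)
    refine Finite.of_injective (fun i : ι => (Pi.mulSingle i (Multiplicative.ofAdd 1) : ι → C)) ?_
    intro i k hik
    by_contra hne
    have := congrFun hik i
    simp only [Pi.mulSingle_eq_same, Pi.mulSingle_eq_of_ne hne] at this
    exact absurd this (by decide)
  have := Fintype.ofFinite ι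
  have hle : Fintype.card ι ≤ s := by
    have h := Nat.card_le_card_of_injective _ (inj C)
    have hC : Nat.card C = 2 := Nat.card_zmod 2
    rw [Nat.card_fun, Nat.card_fun, hC] at h
    simpa using (Nat.pow_le_pow_iff_right (le_refl 2)).1 h
  refine ⟨Fintype.card ι, lt_of_le_of_ne hle ?_, fun i => b ((Fintype.equivFin ι).symm i), ?_⟩
  · intro heq
    rw [injective_iff_map_eq_one] at hni
    push Not at hni
    obtain ⟨w, hw, hw1⟩ := hni
    obtain ⟨P, _, _, φ, hφ⟩ := freeGroup_exists_perm w hw1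
    have := Fintype.ofFinite P
    have hs : Function.Surjective
      (fun (u : ι → P) (i : Fin s) => b.lift u (f (FreeGroup.of i))) := by
      refine ((Fintype.bijective_iff_injective_and_card _).2 ⟨inj P, ?_⟩).2
      simp [heq]
    obtain ⟨u, hu⟩ := hs (fun i => φ (FreeGroup.of i))
    have : (b.lift u).comp f = φ := by
      ext i; exact congrFun hu i
    apply hφ
    rw [← this, MonoidHom.comp_apply, hw, map_one]
  · rw [← MonoidHom.range_eq_top, eq_top_iff]
    rintro x -
    let q : G →* FreeGroup (Fin (Fintype.card ι)) :=
      b.lift (fun i => FreeGroup.of (Fintype.equivFin ι i))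
    refine ⟨q x, ?_⟩
    have : (FreeGroup.lift (fun i => b ((Fintype.equivFin ι).symm i))).comp q = MonoidHom.id G := by
      apply b.ext_hom
      intro i
      simp [q]
    exact DFunLike.congr_fun this x

theorem iInf_nat_le_iff {P : ℕ → Prop} {n : ℕ} :
    (⨅ (r : ℕ) (_ : P r), (r : ℕ∞)) ≤ (n : ℕ∞) ↔ ∃ r ≤ n, P r := by
  constructor
  · intro h
    by_contra! hc
    have : ((n + 1 : ℕ) : ℕ∞) ≤ ⨅ (r : ℕ) (_ : P r), (r : ℕ∞) := by
      refine le_iInf₂ fun r hr => ?_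
      have : n < r := by
        by_contra! h'
        exact hc r h' hr
      exact_mod_cast this
    have := this.trans h
    have : n + 1 ≤ n := by exact_mod_cast this
    omega
  · rintro ⟨r, hr, hP⟩
    exact (iInf₂_le r hP).trans (by exact_mod_cast hr)

theorem subgroupRank_le_iff {Γ : Type*} [Group Γ] (H : Subgroup Γ) (n : ℕ) :
    subgroupRank H ≤ (n : ℕ∞) ↔ ∃ g : Fin n → Γ, (FreeGroup.lift g).range = H := by
  classical
  constructor
  · intro h
    have : ∃ S : Finset Γ, Subgroup.closure (S : Set Γ) = H ∧ S.card ≤ n := by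
      by_contra! hc
      have : ((n + 1 : ℕ) : ℕ∞) ≤ subgroupRank H := by
        refine le_iInf₂ fun S hS => ?_
        exact_mod_cast hc S hS
      have := this.trans h
      have : n + 1 ≤ n := by exact_mod_cast this
      omega
    obtain ⟨S, hS, hc⟩ := this
    refine ⟨fun i => S.toList.getD i 1, ?_⟩
    rw [FreeGroup.range_lift_eq_closure, ← hS]
    apply le_antisymm
    · rw [Subgroup.closure_le]
      rintro _ ⟨i, rfl⟩
      by_cases hi : (i : ℕ) < S.toList.length
      · simp only [List.getD_eq_getElem _ _ hi]
        apply Subgroup.subset_closure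
        exact Finset.mem_toList.1 (List.getElem_mem hi)
      · simp only [List.getD_eq_default _ _ (not_lt.1 hi)]
        exact one_mem _
    · apply Subgroup.closure_mono
      intro x hx
      obtain ⟨i, hi, rfl⟩ := List.getElem_of_mem (Finset.mem_toList.2 hx)
      have hl : S.toList.length = S.card := Finset.length_toList S
      exact ⟨⟨i, by omega⟩, by simp only [List.getD_eq_getElem _ _ hi]⟩
  · rintro ⟨g, rfl⟩
    have : Subgroup.closure ((Finset.univ.image g : Finset Γ) : Set Γ) = (FreeGroup.lift g).range := by
      rw [FreeGroup.range_lift_eq_closure]; simp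
    refine (iInf₂_le (Finset.univ.image g) this).trans ?_
    have := Finset.card_image_le (s := Finset.univ) (f := g)
    rw [Finset.card_univ, Fintype.card_fin] at this
    exact_mod_cast this

theorem LocalRankLE.mono {Γ : Type*} [Group Γ] {A : Subgroup Γ} {r s : ℕ} (h : r ≤ s)
    (hr : LocalRankLE A r) : LocalRankLE A s := by
  intro B hB hf
  obtain ⟨C, h1, h2, h3⟩ := hr B hB hf
  exact ⟨C, h1, h2, h3.trans (by exact_mod_cast h)⟩

theorem localRank_le_iff {Γ : Type*} [Group Γ] (A : Subgroup Γ) (n : ℕ) :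
    localRank A ≤ (n : ℕ∞) ↔ LocalRankLE A n := by
  unfold localRank
  rw [iInf_nat_le_iff]
  exact ⟨fun ⟨r, h, h'⟩ => h'.mono h, fun h => ⟨n, le_rfl, h⟩⟩

theorem kFree_of_lt {Γ : Type*} [Group Γ] {s : ℕ} (h : (s : ℕ∞) < iof Γ) : KFree Γ (s + 1) := by
  unfold iof at h
  simp only [lt_iSup_iff] at h
  obtain ⟨k, hk, hlt⟩ := h
  intro H hH
  have : s < k := by exact_mod_cast hlt
  exact hk H (hH.trans (by exact_mod_cast this))

theorem subgroup_rank_drop {Γ : Type*} [Group Γ] {s : ℕ} (g : Fin s → Γ)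
    (hfree : IsFreeGroup (FreeGroup.lift g).range)
    (hni : ¬ Function.Injective (FreeGroup.lift g)) :
    ∃ n < s, subgroupRank (FreeGroup.lift g).range ≤ (n : ℕ∞) := by
  obtain ⟨n, hn, k, hk⟩ := freeGroup_rank_drop (FreeGroup.lift g).rangeRestrict
    (FreeGroup.lift g).rangeRestrict_surjective
    (by rwa [MonoidHom.rangeRestrict_injective_iff])
  refine ⟨n, hn, (subgroupRank_le_iff _ _).2 ⟨fun i => (k i : Γ), ?_⟩⟩
  have : FreeGroup.lift (fun i => (k i : Γ)) =
      (Subgroup.subtype _).comp (FreeGroup.lift k) := by ext i; simp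
  rw [this, MonoidHom.range_comp, MonoidHom.range_eq_top.2 hk]
  rw [← MonoidHom.range_eq_map, Subgroup.range_subtype]

theorem free_of_stronglyClosable {Γ : Type*} [Group Γ] {B D : Subgroup Γ}
    (hB : StronglyClosable B) (hD : D ≤ B) (hf : D.FG) : IsFreeGroup D := by
  obtain ⟨s, hs⟩ := ENat.ne_top_iff_exists.1 (ne_top_of_lt hB)
  have hB' : (s : ℕ∞) < iof Γ := by rw [hs]; exact hB
  obtain ⟨C, h1, h2, h3⟩ := (localRank_le_iff B s).1 hs.ge D hD hf
  have : IsFreeGroup C := kFree_of_lt hB' C (h3.trans (by exact_mod_cast Nat.le_succ s))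
  exact IsFreeGroup.ofMulEquiv (Subgroup.subgroupOfEquivOfLe h2)

theorem range_iotaAX {Γ : Type*} [Group Γ] (A : Subgroup Γ) (x : Γ) :
    (iotaAX A x).range = A ⊔ Subgroup.closure {x} := by
  unfold iotaAX
  rw [Monoid.Coprod.range_lift, Subgroup.range_subtype, ← Subgroup.zpowers_eq_closure]
  rfl

open Monoid.Coprod in
theorem not_injective_of_admissible {Γ : Type*} [Group Γ] (A : Subgroup Γ) (x : Γ)
    (hfin : localRank A < ⊤) (hx : Admissible A x) : ¬ Function.Injective (iotaAX A x) := by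
  intro hinj
  obtain ⟨r, hr⟩ := ENat.ne_top_iff_exists.1 (ne_top_of_lt (hx.2.trans_lt hfin))
  have key : ∀ B : Subgroup Γ, B ≤ A → B.FG →
      ∃ H : Subgroup Γ, H ≤ A ∧ B ≤ H ∧ ∃ n < r, subgroupRank H ≤ (n : ℕ∞) := by
    intro B hB hf
    have hf' : (B ⊔ Subgroup.closure {x}).FG :=
      hf.sup ⟨{x}, by simp⟩
    obtain ⟨C, hC1, hC2, hC3⟩ := (localRank_le_iff _ r).1 hr.ge _ (sup_le_sup_right hB _) hf'
    obtain ⟨g, rfl⟩ := (subgroupRank_le_iff _ _).1 hC3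
    have hg : ∀ i, ∃ c, iotaAX A x c = g i := by
      intro i
      have : g i ∈ (iotaAX A x).range := by
        rw [range_iotaAX]
        exact hC1 ⟨FreeGroup.of i, by simp⟩
      exact this
    choose g' hg' using hg
    have hlift : ∀ w, iotaAX A x (FreeGroup.lift g' w) = FreeGroup.lift g w := by
      intro w
      have : (iotaAX A x).comp (FreeGroup.lift g') = FreeGroup.lift g := by ext i; simp [hg']
      exact DFunLike.congr_fun this w
    let h : Fin r → Γ := fun i => ((fst (g' i) : A) : Γ)
    have hh : ∀ w, FreeGroup.lift h w = ((fst (FreeGroup.lift g' w) : A) : Γ) := by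
      intro w
      have : FreeGroup.lift h = (A.subtype.comp fst).comp (FreeGroup.lift g') := by
        ext i; simp [h]
      exact DFunLike.congr_fun this w
    have hHA : (FreeGroup.lift h).range ≤ A := by
      rintro _ ⟨w, rfl⟩
      rw [hh]; exact Subtype.property _
    refine ⟨(FreeGroup.lift h).range, hHA, ?_, ?_⟩
    · intro b hb
      obtain ⟨w, hw⟩ := hC2 (Subgroup.mem_sup_left hb)
      refine ⟨w, ?_⟩
      have h1 : FreeGroup.lift g' w = inl ⟨b, hB hb⟩ := by
        apply hinj
        rw [hlift, hw]; simp [iotaAX]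
      rw [hh, h1]; simp
    · apply subgroup_rank_drop
      · apply free_of_stronglyClosable hx.1 (hHA.trans le_sup_left)
        rw [FreeGroup.range_lift_eq_closure]
        rw [Subgroup.fg_iff]
        exact ⟨_, rfl, Set.finite_range _⟩
      · intro hi
        obtain ⟨w, hw⟩ := hC2 (Subgroup.mem_sup_right (Subgroup.subset_closure rfl))
        have h1 : FreeGroup.lift g' w = inr (Multiplicative.ofAdd 1) := by
          apply hinj
          rw [hlift, hw]; simp [iotaAX]
        have h2 : FreeGroup.lift h w = 1 := by
          rw [hh, h1]; simp
        have h3 : w = 1 := hi (by rw [h2, map_one])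
        rw [h3, map_one] at h1
        have h4 : (1 : Multiplicative ℤ) = Multiplicative.ofAdd 1 := by
          apply inr_injective (M := A)
          rw [← h1, map_one]
        exact absurd h4 (by decide)
  have hpos : 0 < r := by
    obtain ⟨_, _, _, n, hn, _⟩ := key ⊥ bot_le ⟨∅, by simp⟩
    omega
  have hle : LocalRankLE A (r - 1) := by
    intro B hB hf
    obtain ⟨H, h1, h2, n, hn, h3⟩ := key B hB hf
    refine ⟨H, h1, h2, h3.trans ?_⟩
    have : n ≤ r - 1 := by omega
    exact_mod_cast this
  have h1 := (localRank_le_iff _ _).2 hle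
  have h2 := hx.2.trans h1
  rw [← hr] at h2
  have h3 : r ≤ r - 1 := by exact_mod_cast h2
  omega

open Monoid.Coprod in
theorem coprod_fin_gen {Γ : Type*} [Group Γ] (B : Subgroup Γ)
    (c : Monoid.Coprod B (Multiplicative ℤ)) :
    ∃ T : Finset B, c ∈ Subgroup.closure
      ((inl '' (T : Set B)) ∪ {(inr (Multiplicative.ofAdd 1) : Monoid.Coprod B (Multiplicative ℤ))}) := by
  classical
  induction c using Monoid.Coprod.induction_on with
  | inl a => exact ⟨{a}, Subgroup.subset_closure (by simp)⟩
  | inr z =>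
    refine ⟨∅, ?_⟩
    have : (inr z : Monoid.Coprod B (Multiplicative ℤ)) =
        inr (Multiplicative.ofAdd 1) ^ (Multiplicative.toAdd z) := by
      rw [← map_zpow, ← ofAdd_zsmul]; simp
    rw [this]
    exact Subgroup.zpow_mem _ (Subgroup.subset_closure (by simp)) _
  | mul u v hu hv =>
    obtain ⟨T, hT⟩ := hu
    obtain ⟨U, hU⟩ := hv
    refine ⟨T ∪ U, mul_mem (Subgroup.closure_mono ?_ hT) (Subgroup.closure_mono ?_ hU)⟩
    · apply Set.union_subset_union_left
      apply Set.image_mono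
      simp
    · apply Set.union_subset_union_left
      apply Set.image_mono
      simp

open Monoid.Coprod in
theorem coprod_fin_gen' {Γ : Type*} [Group Γ] (B : Subgroup Γ)
    (cs : Finset (Monoid.Coprod B (Multiplicative ℤ))) :
    ∃ T : Finset B, ∀ c ∈ cs, c ∈ Subgroup.closure
      ((inl '' (T : Set B)) ∪ {(inr (Multiplicative.ofAdd 1) : Monoid.Coprod B (Multiplicative ℤ))}) := by
  classical
  choose T hT using coprod_fin_gen B
  refine ⟨cs.biUnion T, fun c hc => Subgroup.closure_mono ?_ (hT c)⟩
  apply Set.union_subset_union_left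
  apply Set.image_mono
  exact_mod_cast Finset.subset_biUnion_of_mem T hc

open Monoid.Coprod in
theorem admissible_of_not_injective {Γ : Type*} [Group Γ] (B : Subgroup Γ) (y : Γ)
    (hB : StronglyClosable B) (hni : ¬ Function.Injective (iotaAX B y)) : Admissible B y := by
  classical
  obtain ⟨s, hs⟩ := ENat.ne_top_iff_exists.1 (ne_top_of_lt hB)
  have hB' : (s : ℕ∞) < iof Γ := by rw [hs]; exact hB
  have main : localRank (B ⊔ Subgroup.closure {y}) ≤ localRank B := by
    rw [← hs, localRank_le_iff]
    intro D hD hf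
    rw [injective_iff_map_eq_one] at hni
    push Not at hni
    obtain ⟨w, hw, hw1⟩ := hni
    obtain ⟨S, rfl⟩ := hf
    have hS : ∀ x : S, ∃ c, iotaAX B y c = x := by
      intro x
      have : (x : Γ) ∈ (iotaAX B y).range := by
        rw [range_iotaAX]; exact hD (Subgroup.subset_closure x.2)
      exact this
    choose c hc using hS
    obtain ⟨T, hT⟩ := coprod_fin_gen' B (insert w (Finset.univ.image c))
    obtain ⟨B1, h1, h2, h3⟩ := (localRank_le_iff B s).1 hs.ge
      (Subgroup.closure ((T.image Subtype.val : Finset Γ) : Set Γ))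
      (by
        rw [Subgroup.closure_le]
        intro x hx
        simp only [Finset.coe_image] at hx
        obtain ⟨z, -, rfl⟩ := hx
        exact z.2) ⟨_, rfl⟩
    obtain ⟨g, rfl⟩ := (subgroupRank_le_iff _ _).1 h3
    let g' : Fin s → B := fun i => ⟨g i, h1 ⟨FreeGroup.of i, by simp⟩⟩
    have hg' : ∀ v, ((FreeGroup.lift g' v : B) : Γ) = FreeGroup.lift g v := by
      intro v
      have : B.subtype.comp (FreeGroup.lift g') = FreeGroup.lift g := by ext i; simp [g']
      exact DFunLike.congr_fun this v
    let k : Fin (s + 1) → Monoid.Coprod B (Multiplicative ℤ) :=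
      Fin.cons (inr (Multiplicative.ofAdd 1)) (fun i => inl (g' i))
    have hK : Subgroup.closure ((inl '' (T : Set B)) ∪
        {(inr (Multiplicative.ofAdd 1) : Monoid.Coprod B (Multiplicative ℤ))})
        ≤ (FreeGroup.lift k).range := by
      rw [Subgroup.closure_le]
      rintro _ (⟨t, ht, rfl⟩ | rfl)
      · obtain ⟨v, hv⟩ := h2 (Subgroup.subset_closure (by
          rw [Finset.coe_image]; exact ⟨t, ht, rfl⟩))
        have hv' : FreeGroup.lift g' v = t := by
          apply Subtype.ext; rw [hg', hv]
        refine ⟨FreeGroup.map Fin.succ v, ?_⟩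
        have : (FreeGroup.lift k).comp (FreeGroup.map Fin.succ) =
            inl.comp (FreeGroup.lift g') := by ext i; simp [k]
        rw [← hv']
        exact DFunLike.congr_fun this v
      · exact ⟨FreeGroup.of 0, by simp [k]⟩
    have hlift : ∀ v, FreeGroup.lift (fun i => iotaAX B y (k i)) v =
        iotaAX B y (FreeGroup.lift k v) := by
      intro v
      have : FreeGroup.lift (fun i => iotaAX B y (k i)) =
        (iotaAX B y).comp (FreeGroup.lift k) := by ext i; simp
      exact DFunLike.congr_fun this v
    refine ⟨(FreeGroup.lift (fun i => iotaAX B y (k i))).range, ?_, ?_, ?_⟩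
    · rintro _ ⟨v, rfl⟩
      rw [hlift, ← range_iotaAX]
      exact ⟨_, rfl⟩
    · rw [Subgroup.closure_le]
      intro x hx
      obtain ⟨v, hv⟩ := hK (hT (c ⟨x, hx⟩) (by simp))
      exact ⟨v, by rw [hlift, hv, hc]⟩
    · obtain ⟨n, hn, h⟩ := subgroup_rank_drop (fun i => iotaAX B y (k i))
        (kFree_of_lt hB' _ ((subgroupRank_le_iff _ _).2 ⟨_, rfl⟩))
        (by
          intro hi
          obtain ⟨v, hv⟩ := hK (hT w (by simp))
          have : v = 1 := hi (by rw [hlift, hv, hw, map_one])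
          rw [this, map_one] at hv
          exact hw1 hv.symm)
      refine h.trans ?_
      have : n ≤ s := by omega
      exact_mod_cast this
  exact ⟨main.trans_lt hB, main⟩

theorem iotaAX_injective_mono {Γ : Type*} [Group Γ] {A B : Subgroup Γ} (h : A ≤ B) (y : Γ)
    (hB : Function.Injective (iotaAX B y)) : Function.Injective (iotaAX A y) := by
  have : iotaAX A y = (iotaAX B y).comp
      (Monoid.Coprod.map (Subgroup.inclusion h) (MonoidHom.id (Multiplicative ℤ))) := by
    apply Monoid.Coprod.hom_ext
    · ext a; simp [iotaAX]
    · ext; simp [iotaAX]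
  rw [this]
  exact hB.comp (coprod_map_inj _ (Subgroup.inclusion_injective h))

theorem admissible_mono {Γ : Type*} [Group Γ] {A B : Subgroup Γ} (h : A ≤ B) (y : Γ)
    (hfin : localRank A < ⊤) (hB : StronglyClosable B) (hy : Admissible A y) : Admissible B y :=
  admissible_of_not_injective B y hB fun hi =>
    not_injective_of_admissible A y hfin hy (iotaAX_injective_mono h y hi)

theorem admissibleSeq_mono {Γ : Type*} [Group Γ] (l : List Γ) : ∀ {A B : Subgroup Γ}, A ≤ B →
    localRank A < ⊤ → StronglyClosable B → AdmissibleSeq A l → AdmissibleSeq B l := by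
  induction l with
  | nil => intros; trivial
  | cons y l ih =>
    intro A B h hfin hB hl
    have hy := admissible_mono h y hfin hB hl.1
    exact ⟨hy, ih (sup_le_sup_right h _) (hl.1.2.trans_lt hfin) hy.1 hl.2⟩

theorem admissibleSeq_append {Γ : Type*} [Group Γ] {A : Subgroup Γ} (hfin : localRank A < ⊤)
    (m : List Γ) (hm : AdmissibleSeq A m) (l : List Γ) : ∀ {B : Subgroup Γ}, A ≤ B →
    (StronglyClosable B ∨ l ≠ []) → AdmissibleSeq B l → AdmissibleSeq B (l ++ m) := by
  induction l with
  | nil =>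
    intro B h hB _
    exact admissibleSeq_mono m h hfin (hB.resolve_right (by simp)) hm
  | cons y l ih =>
    intro B h _ hl
    exact ⟨hl.1, ih (h.trans le_sup_left) (Or.inl hl.1.1) hl.2⟩

/-- If `A` is a closable subgroup of `Γ` and `S` is a finite subset of `clo A`, then there
is an `A`-admissible sequence `y₁, …, y_q` with `{y₁, …, y_q} ⊇ S`. -/
theorem exists_admissibleSeq_superset {Γ : Type*} [Group Γ] (A : Subgroup Γ)
    (hA : Closable A) (S : Finset Γ) (hS : (S : Set Γ) ⊆ clo A) :
    ∃ l : List Γ, l ≠ [] ∧ AdmissibleSeq A l ∧ ∀ s ∈ S, s ∈ l := by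
  classical
  induction S using Finset.induction_on with
  | empty =>
    obtain ⟨hfin, z, hz⟩ := hA
    by_cases h : localRank A < iof Γ
    · have h1 : A ⊔ Subgroup.closure {(1 : Γ)} = A := by simp
      exact ⟨[1], by simp, ⟨⟨by unfold StronglyClosable; rw [h1]; exact h, by rw [h1]⟩, trivial⟩,
        by simp⟩
    · exact ⟨[z], by simp, ⟨⟨hz, hz.le.trans (not_lt.1 h)⟩, trivial⟩, by simp⟩
  | insert s S _ ih =>
    obtain ⟨l, hne, hl, hlS⟩ := ih (fun x hx => hS (by simp [Finset.mem_coe.1 hx]))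
    obtain ⟨m, hm⟩ := hS (show s ∈ ((insert s S : Finset Γ) : Set Γ) by simp)
    refine ⟨l ++ (m ++ [s]), by simp, admissibleSeq_append hA.1 _ hm l le_rfl (Or.inr hne) hl, ?_⟩
    intro x hx
    rcases Finset.mem_insert.1 hx with rfl | hx
    · simp
    · simp [hlS x hx]
end
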